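/- The mean curvature vector field of the meridian surface M², given by H = (1/2)(h(x,x) + h(y,y)), equals H = (κ/(2f)) n₁ + ((κ_α f + g')/(2f)) n₂ at every point. -/

import Mathlib

open Matrix

noncomputable section

/-- The embedding of `ℝ³ = span{e₁,e₂,e₃}` into `ℝ⁴`. -/
def emb (p : Fin 3 → ℝ) : Fin 4 → ℝ := ![p 0, p 1, p 2, 0]

/-- The fourth standard basis vector `e₄` of `ℝ⁴`. -/
def e4 : Fin 4 → ℝ := ![0, 0, 0, 1]

/-- Model of the bivector `a ∧ b ∈ Λ²ℝ⁴` as the antisymmetric matrix `aᵢbⱼ − aⱼbᵢ`. -/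
def wedge (a b : Fin 4 → ℝ) : Fin 4 → Fin 4 → ℝ := fun i j => a i * b j - a j * b i

/-- The tangent `t = r'` of the spherical curve `r`. -/
def sphT (r : ℝ → Fin 3 → ℝ) : ℝ → Fin 3 → ℝ := deriv r

/-- The normal `n = r × t` of the spherical curve `r`. -/
def sphN (r : ℝ → Fin 3 → ℝ) (v : ℝ) : Fin 3 → ℝ := crossProduct (r v) (deriv r v)

/-- The spherical curvature `κ = ⟨t', n⟩` of the spherical curve `r`. -/
def sphCurv (r : ℝ → Fin 3 → ℝ) (v : ℝ) : ℝ := deriv (deriv r) v ⬝ᵥ sphN r v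

/-- The curvature `κ_α = f′g″ − g′f″` of the meridian curve `α = (f, g)`. -/
def merCurv (f g : ℝ → ℝ) (u : ℝ) : ℝ :=
  deriv f u * deriv (deriv g) u - deriv g u * deriv (deriv f) u

/-- The parametrization `z(u,v) = f(u) r(v) + g(u) e₄` of the meridian surface `M²`. -/
def mz (f g : ℝ → ℝ) (r : ℝ → Fin 3 → ℝ) (u v : ℝ) : Fin 4 → ℝ :=
  f u • emb (r v) + g u • e4

/-- The tangent frame vector `x = ∂z/∂u = f′ r + g′ e₄`. -/
def mx (f g : ℝ → ℝ) (r : ℝ → Fin 3 → ℝ) (u v : ℝ) : Fin 4 → ℝ :=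
  deriv f u • emb (r v) + deriv g u • e4

/-- The tangent frame vector `y = (1/f) ∂z/∂v = t`. -/
def my (r : ℝ → Fin 3 → ℝ) (v : ℝ) : Fin 4 → ℝ := emb (deriv r v)

/-- The normal frame vector `n₁ = n`. -/
def mn1 (r : ℝ → Fin 3 → ℝ) (v : ℝ) : Fin 4 → ℝ := emb (sphN r v)

/-- The normal frame vector `n₂ = −g′ r + f′ e₄`. -/
def mn2 (f g : ℝ → ℝ) (r : ℝ → Fin 3 → ℝ) (u v : ℝ) : Fin 4 → ℝ :=
  (-(deriv g u)) • emb (r v) + deriv f u • e4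

/-- The Gauss map `G = x ∧ y` of the meridian surface, with values in `Λ²ℝ⁴`. -/
def gaussG (f g : ℝ → ℝ) (r : ℝ → Fin 3 → ℝ) (u v : ℝ) : Fin 4 → Fin 4 → ℝ :=
  wedge (mx f g r u v) (my r v)

/-- The Laplacian `Δφ = −(∂²φ/∂u² + (1/f²) ∂²φ/∂v² + (f′/f) ∂φ/∂u)` of the meridian
surface, acting on `Λ²ℝ⁴`-valued functions. -/
def surfLap (f : ℝ → ℝ) (φ : ℝ → ℝ → Fin 4 → Fin 4 → ℝ) (u v : ℝ) : Fin 4 → Fin 4 → ℝ :=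
  -(deriv (deriv (fun s => φ s v)) u + (1 / f u ^ 2) • deriv (deriv (fun s => φ u s)) v
    + (deriv f u / f u) • deriv (fun s => φ s v) u)

/-- `h(x,x)`: the normal component (w.r.t. `{n₁, n₂}`) of `∇′ₓx = ∂x/∂u`. -/
def hxx (f g : ℝ → ℝ) (r : ℝ → Fin 3 → ℝ) (u v : ℝ) : Fin 4 → ℝ :=
  (deriv (fun s => mx f g r s v) u ⬝ᵥ mn1 r v) • mn1 r v
    + (deriv (fun s => mx f g r s v) u ⬝ᵥ mn2 f g r u v) • mn2 f g r u v

/-- `h(x,y)`: the normal component (w.r.t. `{n₁, n₂}`) of `∇′_y x = (1/f) ∂x/∂v`. -/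
def hxy (f g : ℝ → ℝ) (r : ℝ → Fin 3 → ℝ) (u v : ℝ) : Fin 4 → ℝ :=
  (((1 / f u) • deriv (fun s => mx f g r u s) v) ⬝ᵥ mn1 r v) • mn1 r v
    + (((1 / f u) • deriv (fun s => mx f g r u s) v) ⬝ᵥ mn2 f g r u v) • mn2 f g r u v

/-- `h(y,y)`: the normal component (w.r.t. `{n₁, n₂}`) of `∇′_y y = (1/f) ∂y/∂v`. -/
def hyy (f g : ℝ → ℝ) (r : ℝ → Fin 3 → ℝ) (u v : ℝ) : Fin 4 → ℝ :=
  (((1 / f u) • deriv (my r) v) ⬝ᵥ mn1 r v) • mn1 r v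
    + (((1 / f u) • deriv (my r) v) ⬝ᵥ mn2 f g r u v) • mn2 f g r u v


theorem emb_dotProduct_emb (p q : Fin 3 → ℝ) : emb p ⬝ᵥ emb q = p ⬝ᵥ q := by
  simp [emb, dotProduct, Fin.sum_univ_succ]

theorem emb_dotProduct_e4 (p : Fin 3 → ℝ) : emb p ⬝ᵥ e4 = 0 := by
  simp [emb, e4, dotProduct, Fin.sum_univ_succ]

theorem e4_dotProduct_emb (p : Fin 3 → ℝ) : e4 ⬝ᵥ emb p = 0 := by
  rw [dotProduct_comm, emb_dotProduct_e4]

theorem e4_dotProduct_e4 : e4 ⬝ᵥ e4 = 1 := by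
  simp [e4, dotProduct, Fin.sum_univ_succ]

theorem HasDerivAt.emb {r : ℝ → Fin 3 → ℝ} {r' : Fin 3 → ℝ} {v : ℝ}
    (h : HasDerivAt r r' v) : HasDerivAt (fun s => emb (r s)) (emb r') v := by
  have h' := hasDerivAt_pi.1 h
  refine hasDerivAt_pi.2 fun i => ?_
  fin_cases i
  · simpa [_root_.emb] using h' 0
  · simpa [_root_.emb] using h' 1
  · simpa [_root_.emb] using h' 2
  · simpa [_root_.emb] using hasDerivAt_const v (0 : ℝ)

theorem HasDerivAt.dotProduct {n : Type*} [Fintype n] {a b : ℝ → n → ℝ} {a' b' : n → ℝ} {v : ℝ}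
    (ha : HasDerivAt a a' v) (hb : HasDerivAt b b' v) :
    HasDerivAt (fun s => a s ⬝ᵥ b s) (a' ⬝ᵥ b v + a v ⬝ᵥ b') v := by
  have h := HasDerivAt.fun_sum (u := Finset.univ)
    fun i _ => (hasDerivAt_pi.1 ha i).mul (hasDerivAt_pi.1 hb i)
  rw [Finset.sum_add_distrib] at h
  exact h

/-- A smooth function on an open set is twice differentiable there. -/
theorem ContDiffOn.hasDerivAt_and_hasDerivAt_deriv {E : Type*} [NormedAddCommGroup E]
    [NormedSpace ℝ E] {s : Set ℝ} {φ : ℝ → E} (hφ : ContDiffOn ℝ (⊤ : ℕ∞) φ s) (hs : IsOpen s)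
    {x : ℝ} (hx : x ∈ s) :
    HasDerivAt φ (deriv φ x) x ∧ HasDerivAt (deriv φ) (deriv (deriv φ) x) x :=
  ⟨((hφ.differentiableOn (by simp)).differentiableAt (hs.mem_nhds hx)).hasDerivAt,
    (((hφ.deriv_of_isOpen (m := (⊤ : ℕ∞)) hs le_rfl).differentiableOn
      (by simp)).differentiableAt (hs.mem_nhds hx)).hasDerivAt⟩

/-- A vector function of constant self-pairing is orthogonal to its derivative. -/
theorem deriv_dotProduct_self_eq_zero {n : Type*} [Fintype n] {s : Set ℝ} (hs : IsOpen s)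
    {a : ℝ → n → ℝ} {c : ℝ} (hc : ∀ x ∈ s, a x ⬝ᵥ a x = c) {v : ℝ} (hv : v ∈ s)
    (ha : HasDerivAt a (deriv a v) v) : deriv a v ⬝ᵥ a v = 0 := by
  have h := ha.dotProduct ha
  have h0 : HasDerivAt (fun x => a x ⬝ᵥ a x) 0 v :=
    (hasDerivAt_const v c).congr_of_eventuallyEq
      (Filter.eventually_of_mem (hs.mem_nhds hv) hc)
  have := h.unique h0
  rw [dotProduct_comm (a v)] at this
  linarith

/-- The acceleration of a unit speed curve on the unit sphere has radial component `-1`. -/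
theorem deriv_deriv_dotProduct_of_sphere {n : Type*} [Fintype n] {J : Set ℝ} (hJ : IsOpen J)
    {r : ℝ → n → ℝ} (hr : ContDiffOn ℝ (⊤ : ℕ∞) r J) (hrs : ∀ v ∈ J, r v ⬝ᵥ r v = 1)
    (hra : ∀ v ∈ J, deriv r v ⬝ᵥ deriv r v = 1) {v : ℝ} (hv : v ∈ J) :
    deriv (deriv r) v ⬝ᵥ r v = -1 := by
  obtain ⟨h1, h2⟩ := hr.hasDerivAt_and_hasDerivAt_deriv hJ hv
  have h0 : HasDerivAt (fun x => deriv r x ⬝ᵥ r x) 0 v :=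
    (hasDerivAt_const v (0 : ℝ)).congr_of_eventuallyEq
      (Filter.eventually_of_mem (hJ.mem_nhds hv) fun x hx =>
        deriv_dotProduct_self_eq_zero hJ hrs hx (hr.hasDerivAt_and_hasDerivAt_deriv hJ hx).1)
  have := (h2.dotProduct h1).unique h0
  linarith [hra v hv]

/-- The mean curvature vector `H = (1/2)(h(x,x) + h(y,y))` of the
meridian surface equals `H = (κ/(2f)) n₁ + ((κ_α f + g′)/(2f)) n₂`. -/
theorem meridian_surface_mean_curvature_vector
    (I J : Set ℝ) (hI : IsOpen I) (hIiv : I.OrdConnected) (hIne : I.Nonempty)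
    (hJ : IsOpen J) (hJiv : J.OrdConnected) (hJne : J.Nonempty)
    (r : ℝ → Fin 3 → ℝ) (hr : ContDiffOn ℝ (⊤ : ℕ∞) r J)
    (hrs : ∀ v ∈ J, r v ⬝ᵥ r v = 1) (hra : ∀ v ∈ J, deriv r v ⬝ᵥ deriv r v = 1)
    (f g : ℝ → ℝ) (hf : ContDiffOn ℝ (⊤ : ℕ∞) f I) (hg : ContDiffOn ℝ (⊤ : ℕ∞) g I)
    (hf0 : ∀ u ∈ I, f u ≠ 0) (hfg : ∀ u ∈ I, deriv f u ^ 2 + deriv g u ^ 2 = 1) :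
    ∀ u ∈ I, ∀ v ∈ J,
      (1 / 2 : ℝ) • (hxx f g r u v + hyy f g r u v)
        = (sphCurv r v / (2 * f u)) • mn1 r v
          + ((merCurv f g u * f u + deriv g u) / (2 * f u)) • mn2 f g r u v := by
  intro u hu v hv
  have hr2 := (hr.hasDerivAt_and_hasDerivAt_deriv hJ hv).2
  have hf2 := (hf.hasDerivAt_and_hasDerivAt_deriv hI hu).2
  have hg2 := (hg.hasDerivAt_and_hasDerivAt_deriv hI hu).2
  have hrad := deriv_deriv_dotProduct_of_sphere hJ hr hrs hra hv
  have hx : deriv (fun s => mx f g r s v) u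
      = deriv (deriv f) u • emb (r v) + deriv (deriv g) u • e4 :=
    ((hf2.smul_const _).add (hg2.smul_const _)).deriv
  have hy : deriv (my r) v = emb (deriv (deriv r) v) := hr2.emb.deriv
  have hrn : r v ⬝ᵥ sphN r v = 0 := dot_self_cross _ _
  have hfu := hf0 u hu
  rw [hxx, hyy, hx, hy]
  simp only [mn1, mn2, add_dotProduct, dotProduct_add, smul_dotProduct, dotProduct_smul,
    emb_dotProduct_emb, emb_dotProduct_e4, e4_dotProduct_emb, e4_dotProduct_e4, hrs v hv, hrad,
    hrn, smul_eq_mul, sphCurv, merCurv]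
  match_scalars <;> field_simp <;> ring
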